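/- arXiv:math/0605030 — 2 statements merged into one kernel-verified Lean document; each statement's English description precedes it below -/
import Mathlib

section
/- Let E be a vector lattice with the projection property and F a K-space. For each band projection π of E, the map π̂ : T ↦ T∘π is a band projection on the Dedekind complete vector lattice L~(E,F) of order bounded operators, and the set 𝒫° := {π̂ : π a band projection of E} is a generating set of band projections in L~(E,F). -/
/-! Statement 9: If `E` is a vector lattice with the projection property and `F` a K-space,
then for every band projection `π` of `E` the map `π̂ : T ↦ T ∘ π` is a band projection on the
Dedekind complete vector lattice `L~(E,F)` of order bounded operators, and the collection
`𝒫° = {π̂}` is a generating set of band projections in `L~(E,F)`. -/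

universe u v

variable {E : Type u} {F : Type v}

/-- Order bounded: maps order intervals to order bounded sets. -/
def OrderBounded [Lattice E] [AddCommGroup E] [Module ℝ E]
    [Lattice F] [AddCommGroup F] [Module ℝ F] (T : E →ₗ[ℝ] F) : Prop :=
  ∀ a b : E, ∃ c d : F, ∀ x : E, a ≤ x → x ≤ b → c ≤ T x ∧ T x ≤ d

/-- The operator order: `S ≤ T` iff `S x ≤ T x` for all `x ≥ 0`. -/
def opLE [Lattice E] [AddCommGroup E] [Module ℝ E]
    [Lattice F] [AddCommGroup F] [Module ℝ F] (S T : E →ₗ[ℝ] F) : Prop :=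
  ∀ x : E, 0 ≤ x → S x ≤ T x

/-- A band projection on `E`. -/
def IsBandProjection [Lattice E] [AddCommGroup E] [Module ℝ E] (π : E →ₗ[ℝ] E) : Prop :=
  π.comp π = π ∧ ∀ x : E, 0 ≤ x → 0 ≤ π x ∧ π x ≤ x

/-- The disjoint complement of a set. -/
def disjComplement [Lattice E] [AddCommGroup E] (M : Set E) : Set E :=
  {x | ∀ y ∈ M, |x| ⊓ |y| = 0}

/-- A band of `E`. -/
def IsBand [Lattice E] [AddCommGroup E] (B : Set E) : Prop :=
  ∃ M : Set E, M.Nonempty ∧ B = disjComplement M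

/-- A band projection on the vector lattice `L~(E,F)` of order bounded operators:
a linear idempotent map preserving order boundedness with `0 ≤ P T ≤ T` for `T ≥ 0`. -/
def IsBandProjLb [Lattice E] [AddCommGroup E] [Module ℝ E]
    [Lattice F] [AddCommGroup F] [Module ℝ F]
    (P : (E →ₗ[ℝ] F) → (E →ₗ[ℝ] F)) : Prop :=
  (∀ S T : E →ₗ[ℝ] F, P (S + T) = P S + P T) ∧
  (∀ (c : ℝ) (T : E →ₗ[ℝ] F), P (c • T) = c • P T) ∧
  (∀ T : E →ₗ[ℝ] F, P (P T) = P T) ∧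
  (∀ T : E →ₗ[ℝ] F, OrderBounded T → OrderBounded (P T)) ∧
  (∀ T : E →ₗ[ℝ] F, OrderBounded T → opLE 0 T → opLE 0 (P T) ∧ opLE (P T) T)

theorem IsBandProjection.monotone [Lattice E] [AddCommGroup E] [Module ℝ E]
    [CovariantClass E E (· + ·) (· ≤ ·)] {π : E →ₗ[ℝ] E} (hπ : IsBandProjection π) :
    Monotone π := by
  intro a b hab
  have h := (hπ.2 (b - a) (sub_nonneg.2 hab)).1
  rwa [map_sub, sub_nonneg] at h

theorem IsBandProjection.apply_of_mem_range [Lattice E] [AddCommGroup E] [Module ℝ E]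
    {π : E →ₗ[ℝ] E} (hπ : IsBandProjection π) {x : E} (hx : x ∈ Set.range π) : π x = x := by
  obtain ⟨y, rfl⟩ := hx
  exact LinearMap.congr_fun hπ.1 y

theorem monotone_of_opLE_zero [Lattice E] [AddCommGroup E] [Module ℝ E]
    [CovariantClass E E (· + ·) (· ≤ ·)] [Lattice F] [AddCommGroup F] [Module ℝ F]
    [CovariantClass F F (· + ·) (· ≤ ·)] {T : E →ₗ[ℝ] F} (hT : opLE 0 T) :
    Monotone T := by
  intro a b hab
  have h := hT (b - a) (sub_nonneg.2 hab)
  rwa [LinearMap.zero_apply, map_sub, sub_nonneg] at h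

theorem OrderBounded.comp_bandProjection [Lattice E] [AddCommGroup E] [Module ℝ E]
    [CovariantClass E E (· + ·) (· ≤ ·)] [Lattice F] [AddCommGroup F] [Module ℝ F]
    {T : E →ₗ[ℝ] F} (hT : OrderBounded T) {π : E →ₗ[ℝ] E} (hπ : IsBandProjection π) :
    OrderBounded (T.comp π) := by
  intro a b
  obtain ⟨c, d, h⟩ := hT (π a) (π b)
  exact ⟨c, d, fun x hax hxb => h (π x) (hπ.monotone hax) (hπ.monotone hxb)⟩

theorem isBandProjLb_comp [Lattice E] [AddCommGroup E] [Module ℝ E]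
    [CovariantClass E E (· + ·) (· ≤ ·)] [Lattice F] [AddCommGroup F] [Module ℝ F]
    [CovariantClass F F (· + ·) (· ≤ ·)] {π : E →ₗ[ℝ] E} (hπ : IsBandProjection π) :
    IsBandProjLb (fun T : E →ₗ[ℝ] F => T.comp π) := by
  refine ⟨fun S T => LinearMap.add_comp π T S, fun c T => LinearMap.smul_comp c T π,
    fun T => ?_, fun T hT => hT.comp_bandProjection hπ,
    fun T _ hT => ⟨fun x hx => hT (π x) (hπ.2 x hx).1,
      fun x hx => monotone_of_opLE_zero hT (hπ.2 x hx).2⟩⟩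
  change (T.comp π).comp π = T.comp π
  rw [LinearMap.comp_assoc, hπ.1]

/-- The projection onto the disjoint complement of `x⁻` sends `x` to `x⁺`. -/
theorem exists_bandProjection_apply_eq_sup_zero [Lattice E] [AddCommGroup E] [Module ℝ E]
    [CovariantClass E E (· + ·) (· ≤ ·)]
    (hProj : ∀ B : Set E, IsBand B →
      ∃ π : E →ₗ[ℝ] E, IsBandProjection π ∧ Set.range ⇑π = B) (x : E) :
    ∃ π : E →ₗ[ℝ] E, IsBandProjection π ∧ π x = x ⊔ 0 := by
  obtain ⟨π, hπ, hrange⟩ := hProj (disjComplement {x⁻}) ⟨_, Set.singleton_nonempty _, rfl⟩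
  have hneg : 0 ≤ x⁻ := negPart_nonneg x
  have hfix : π x⁺ = x⁺ := by
    apply hπ.apply_of_mem_range
    rw [hrange]
    rintro y rfl
    rw [abs_of_nonneg (posPart_nonneg x), abs_of_nonneg hneg]
    exact posPart_inf_negPart_eq_zero x
  have hkill : π x⁻ = 0 := by
    have hmem : π x⁻ ∈ disjComplement {x⁻} := hrange ▸ Set.mem_range_self x⁻
    have h := hmem x⁻ rfl
    obtain ⟨h0, h1⟩ := hπ.2 x⁻ hneg
    rwa [abs_of_nonneg h0, abs_of_nonneg hneg, inf_eq_left.2 h1] at h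
  refine ⟨π, hπ, ?_⟩
  conv_lhs => rw [← posPart_sub_negPart x]
  rw [map_sub, hfix, hkill, sub_zero, posPart_def]

theorem composition_band_projections_generate
    [Lattice E] [AddCommGroup E] [Module ℝ E]
    [CovariantClass E E (· + ·) (· ≤ ·)] [PosSMulMono ℝ E]
    [ConditionallyCompleteLattice F] [AddCommGroup F] [Module ℝ F]
    [CovariantClass F F (· + ·) (· ≤ ·)] [PosSMulMono ℝ F]
    (hArchE : ∀ x y : E, (∀ n : ℕ, n • x ≤ y) → x ≤ 0)
    (hArchF : ∀ x y : F, (∀ n : ℕ, n • x ≤ y) → x ≤ 0)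
    (hProj : ∀ B : Set E, IsBand B →
      ∃ π : E →ₗ[ℝ] E, IsBandProjection π ∧ Set.range ⇑π = B) :
    (∀ π : E →ₗ[ℝ] E, IsBandProjection π →
        IsBandProjLb (fun T : E →ₗ[ℝ] F => T.comp π)) ∧
    (∀ T : E →ₗ[ℝ] F, OrderBounded T → opLE 0 T → ∀ x : E,
        IsLUB ((fun P : (E →ₗ[ℝ] F) → (E →ₗ[ℝ] F) => P T x) ''
            {P | ∃ π : E →ₗ[ℝ] E, IsBandProjection π ∧
              P = fun T : E →ₗ[ℝ] F => T.comp π})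
          (T (x ⊔ 0))) := by
  refine ⟨fun π hπ => isBandProjLb_comp hπ, fun T _ hT x => IsGreatest.isLUB ⟨?_, ?_⟩⟩
  · obtain ⟨π, hπ, hx⟩ := exists_bandProjection_apply_eq_sup_zero hProj x
    exact ⟨_, ⟨π, hπ, rfl⟩, congrArg T hx⟩
  · rintro _ ⟨_, ⟨π, hπ, rfl⟩, rfl⟩
    exact monotone_of_opLE_zero hT
      ((hπ.monotone le_sup_left).trans (hπ.2 (x ⊔ 0) le_sup_right).2)
end

section
/- Let E and F be K-spaces and let S, T : E → F be order continuous positive linear operators, where T is a Maharam operator. Then the following are equivalent: (1) S belongs to the band {T}^⊥⊥ generated by T in the Dedekind complete vector lattice L~(E,F) of order bounded operators; (2) Sx belongs to the band {Tx}^⊥⊥ of F for every x ∈ E₊; (3) there exists a sequence (ρ_n) of positive orthomorphisms of E such that Sx = sup_n T(ρ_n x) for all x ∈ E₊. -/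
/-! Statement 19 (Radon–Nikodým): For order continuous positive operators `S, T : E → F`
between K-spaces with `T` a Maharam operator, the following are equivalent:
(1) `S ∈ {T}^⊥⊥` in `L~(E,F)`; (2) `Sx ∈ {Tx}^⊥⊥` for every `x ∈ E₊`;
(3) there is a sequence `(ρ_n)` of positive orthomorphisms of `E` with
`Sx = sup_n T(ρ_n x)` for all `x ∈ E₊`. -/

universe u v

variable {E : Type u} {F : Type v}

/-- `m = |T|` in `L~(E,F)`: the least order bounded upper bound of `{T, -T}`. -/
def IsModOp [Lattice E] [AddCommGroup E] [Module ℝ E]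
    [Lattice F] [AddCommGroup F] [Module ℝ F] (T m : E →ₗ[ℝ] F) : Prop :=
  OrderBounded m ∧ opLE T m ∧ opLE (-T) m ∧
    ∀ R : E →ₗ[ℝ] F, OrderBounded R → opLE T R → opLE (-T) R → opLE m R

/-- The infimum in `L~(E,F)` of the two positive operators `u, v` is zero. -/
def InfZeroOp [Lattice E] [AddCommGroup E] [Module ℝ E]
    [Lattice F] [AddCommGroup F] [Module ℝ F] (u v : E →ₗ[ℝ] F) : Prop :=
  opLE 0 u ∧ opLE 0 v ∧
    ∀ w : E →ₗ[ℝ] F, OrderBounded w → opLE w u → opLE w v → opLE w 0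

/-- Disjointness in `L~(E,F)`: `|S| ∧ |T| = 0`. -/
def DisjOp [Lattice E] [AddCommGroup E] [Module ℝ E]
    [Lattice F] [AddCommGroup F] [Module ℝ F] (S T : E →ₗ[ℝ] F) : Prop :=
  ∃ mS mT : E →ₗ[ℝ] F, IsModOp S mS ∧ IsModOp T mT ∧ InfZeroOp mS mT

/-- `S` belongs to the band `{T}^⊥⊥` generated by `T` in `L~(E,F)`. -/
def InBandOp [Lattice E] [AddCommGroup E] [Module ℝ E]
    [Lattice F] [AddCommGroup F] [Module ℝ F] (T S : E →ₗ[ℝ] F) : Prop :=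
  ∀ R : E →ₗ[ℝ] F, OrderBounded R → DisjOp R T → DisjOp S R

/-- `y` belongs to the band `{z}^⊥⊥` generated by `z` in `F`. -/
def InBandF [Lattice F] [AddCommGroup F] (z y : F) : Prop :=
  ∀ w : F, |w| ⊓ |z| = 0 → |y| ⊓ |w| = 0

/-- Order continuity: `T` carries decreasing nets with infimum `0` to families with
infimum `0`. -/
def OrderContinuous' [Lattice E] [AddCommGroup E] [Module ℝ E]
    [Lattice F] [AddCommGroup F] [Module ℝ F] (T : E →ₗ[ℝ] F) : Prop :=
  ∀ D : Set E, D.Nonempty → DirectedOn (fun a b => b ≤ a) D → IsGLB D 0 →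
    IsGLB (⇑T '' D) 0

set_option linter.unusedSectionVars false

section OrderBasics

variable [Lattice E] [AddCommGroup E] [IsOrderedAddMonoid E]

theorem inf_add_le_inf_add_inf {a b w : E} (ha : 0 ≤ a) (hb : 0 ≤ b) (hw : 0 ≤ w) :
    (a + b) ⊓ w ≤ a ⊓ w + b ⊓ w := by
  rw [add_inf, inf_add, inf_add]
  refine le_inf (le_inf inf_le_left ?_) (le_inf ?_ ?_) <;> refine inf_le_right.trans ?_
  · exact le_add_of_nonneg_right hb
  · exact le_add_of_nonneg_left ha
  · exact le_add_of_nonneg_right hw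

theorem nonneg_add_inf_decomp {a b y : E} (ha : 0 ≤ a) (hb : 0 ≤ b) (hy : 0 ≤ y)
    (h : y ≤ a + b) : ∃ y₁ y₂, 0 ≤ y₁ ∧ 0 ≤ y₂ ∧ y₁ ≤ a ∧ y₂ ≤ b ∧ y = y₁ + y₂ := by
  refine ⟨y ⊓ a, y - y ⊓ a, le_inf hy ha, sub_nonneg.2 inf_le_left, inf_le_right, ?_, by abel⟩
  rw [sub_inf, sub_self]
  exact sup_le hb (sub_le_iff_le_add'.2 h)

variable [Module ℝ E]

/-- Bands: solid subspaces closed under suprema of upward directed families of positive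
elements. -/
structure IsOrderBand (B : Submodule ℝ E) : Prop where
  solid : ∀ x ∈ B, ∀ y : E, |y| ≤ |x| → y ∈ B
  sup_mem : ∀ (A : Set E) (x : E), A ⊆ B → A.Nonempty → DirectedOn (· ≤ ·) A →
    (∀ a ∈ A, 0 ≤ a) → IsLUB A x → x ∈ B

theorem IsOrderBand.mem_of_le {B : Submodule ℝ E} (hB : IsOrderBand B) {x y : E} (hx : x ∈ B)
    (hy : 0 ≤ y) (hyx : y ≤ x) : y ∈ B :=
  hB.solid x hx y (by rwa [abs_of_nonneg hy, abs_of_nonneg (hy.trans hyx)])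

variable [PosSMulMono ℝ E]

theorem abs_smul_le_nsmul_abs (c : ℝ) (x : E) {n : ℕ} (hn : |c| ≤ n) : |c • x| ≤ n • |x| := by
  have key : ∀ d : ℝ, 0 ≤ d → d ≤ n → ∀ y : E, y ≤ |x| → d • y ≤ n • |x| := by
    intro d hd hdn y hy
    refine (smul_le_smul_of_nonneg_left hy hd).trans ?_
    have h := smul_nonneg (sub_nonneg.2 hdn) (abs_nonneg x)
    rwa [sub_smul, sub_nonneg, Nat.cast_smul_eq_nsmul] at h
  rcases abs_le.1 hn with ⟨h1, h2⟩
  rw [abs_le']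
  rcases le_total 0 c with hc | hc
  · refine ⟨key c hc h2 x (le_abs_self x), ?_⟩
    rw [← smul_neg]
    exact key c hc h2 (-x) (neg_le_abs x)
  · have h0 : 0 ≤ -c := neg_nonneg.2 hc
    have h3 : -c ≤ n := by linarith
    refine ⟨?_, ?_⟩
    · rw [← neg_smul_neg]
      exact key (-c) h0 h3 (-x) (neg_le_abs x)
    · rw [← neg_smul]
      exact key (-c) h0 h3 x (le_abs_self x)

/-- A nonempty solid set closed under addition, as a subspace. -/
def solidSubmodule (C : Set E) (hne : (0 : E) ∈ C) (hadd : ∀ x ∈ C, ∀ y ∈ C, x + y ∈ C)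
    (hsolid : ∀ x ∈ C, ∀ y : E, |y| ≤ |x| → y ∈ C) : Submodule ℝ E where
  carrier := C
  zero_mem' := hne
  add_mem' := fun {x y} hx hy => hadd x hx y hy
  smul_mem' := by
    intro c x hx
    obtain ⟨n, hn⟩ := exists_nat_ge |c|
    have habs : |x| ∈ C := hsolid x hx _ (abs_abs x).le
    have hmul : ∀ m : ℕ, m • |x| ∈ C := by
      intro m
      induction m with
      | zero => simpa using hne
      | succ k ih => rw [succ_nsmul]; exact hadd _ ih _ habs
    refine hsolid _ (hmul n) _ ?_
    rw [abs_of_nonneg (nsmul_nonneg (abs_nonneg x) n)]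
    exact abs_smul_le_nsmul_abs c x hn

/-- The disjoint complement of a set. -/
def perp (W : Set E) : Submodule ℝ E :=
  solidSubmodule {x | ∀ w ∈ W, |x| ⊓ |w| = 0}
    (by intro w _; simp)
    (by
      intro x hx y hy w hw
      refine le_antisymm ?_ (le_inf (abs_nonneg _) (abs_nonneg _))
      refine (inf_le_inf_right _ (abs_add_le x y)).trans ?_
      refine (inf_add_le_inf_add_inf (abs_nonneg x) (abs_nonneg y) (abs_nonneg w)).trans ?_
      rw [hx w hw, hy w hw, add_zero])
    (by
      intro x hx y hyx w hw
      refine le_antisymm ?_ (le_inf (abs_nonneg _) (abs_nonneg _))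
      exact (inf_le_inf_right _ hyx).trans (hx w hw).le)

theorem mem_perp {W : Set E} {x : E} : x ∈ perp W ↔ ∀ w ∈ W, |x| ⊓ |w| = 0 := Iff.rfl

theorem mem_perp_singleton {w x : E} : x ∈ perp {w} ↔ |x| ⊓ |w| = 0 := by
  simp [mem_perp]

theorem mem_perp_perp_self (w : E) : w ∈ perp (perp {w} : Set E) := by
  intro v hv
  rw [inf_comm]
  exact hv w rfl

theorem mem_perp_of_isLUB {W A : Set E} {x : E} (hA : ∀ a ∈ A, a ∈ perp W) (hne : A.Nonempty)
    (hpos : ∀ a ∈ A, 0 ≤ a) (hx : IsLUB A x) : x ∈ perp W := by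
  intro w hw
  obtain ⟨a₀, ha₀⟩ := hne
  have hx0 : 0 ≤ x := (hpos a₀ ha₀).trans (hx.1 ha₀)
  rw [abs_of_nonneg hx0]
  refine le_antisymm ?_ (le_inf hx0 (abs_nonneg _))
  have h : x ≤ x - x ⊓ |w| := by
    refine hx.2 ?_
    intro a ha
    have h1 : a ⊓ (x ⊓ |w|) = 0 := by
      refine le_antisymm ?_ (le_inf (hpos a ha) (le_inf hx0 (abs_nonneg _)))
      refine (inf_le_inf_left a inf_le_right).trans ?_
      have := hA a ha w hw
      rw [abs_of_nonneg (hpos a ha)] at this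
      exact this.le
    have h2 := inf_add_sup a (x ⊓ |w|)
    rw [h1, zero_add] at h2
    rw [le_sub_iff_add_le, ← h2]
    exact sup_le (hx.1 ha) inf_le_left
  exact (le_sub_self_iff x).1 h

theorem isOrderBand_perp (W : Set E) : IsOrderBand (perp W) where
  solid := by
    intro x hx y hyx w hw
    refine le_antisymm ?_ (le_inf (abs_nonneg _) (abs_nonneg _))
    exact (inf_le_inf_right _ hyx).trans (hx w hw).le
  sup_mem := fun _ _ hA hne _ hpos hx => mem_perp_of_isLUB hA hne hpos hx

theorem eq_zero_of_mem_of_mem_perp {W : Set E} {x : E} (hx : x ∈ W) (hx' : x ∈ perp W) :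
    x = 0 := by
  have h := hx' x hx
  rw [inf_idem] at h
  exact le_antisymm ((le_abs_self x).trans h.le) (neg_nonpos.1 ((neg_le_abs x).trans h.le))

theorem eq_and_eq_of_add_eq_add {B : Submodule ℝ E} {a b a' b' : E} (ha : a ∈ B) (ha' : a' ∈ B)
    (hb : b ∈ perp (B : Set E)) (hb' : b' ∈ perp (B : Set E)) (h : a + b = a' + b') :
    a = a' ∧ b = b' := by
  have h1 : a - a' = b' - b := by rw [sub_eq_sub_iff_add_eq_add, h, add_comm]
  have h2 : a - a' = 0 := by
    refine eq_zero_of_mem_of_mem_perp (W := (B : Set E)) (B.sub_mem ha ha') ?_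
    rw [h1]
    exact Submodule.sub_mem _ hb' hb
  refine ⟨sub_eq_zero.1 h2, ?_⟩
  rw [h2] at h1
  exact (sub_eq_zero.1 h1.symm).symm

theorem negPart_mem_perp_posPart (c : E) : c⁻ ∈ perp {c⁺} := by
  rw [mem_perp_singleton, abs_of_nonneg (negPart_nonneg c), abs_of_nonneg (posPart_nonneg c),
    inf_comm]
  exact posPart_inf_negPart_eq_zero c

end OrderBasics

section BandProjection

variable [ConditionallyCompleteLattice E] [AddCommGroup E] [IsOrderedAddMonoid E]
  [Module ℝ E] [PosSMulMono ℝ E]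

theorem IsOrderBand.exists_decomp {B : Submodule ℝ E} (hB : IsOrderBand B) {x : E} (hx : 0 ≤ x) :
    ∃ a b, 0 ≤ a ∧ 0 ≤ b ∧ a ∈ B ∧ b ∈ perp (B : Set E) ∧ x = a + b := by
  set A : Set E := {z | z ∈ B ∧ 0 ≤ z ∧ z ≤ x} with hA
  have hne : A.Nonempty := ⟨0, B.zero_mem, le_rfl, hx⟩
  have hbdd : BddAbove A := ⟨x, fun z hz => hz.2.2⟩
  have hlub : IsLUB A (sSup A) := isLUB_csSup hne hbdd
  have hdir : DirectedOn (· ≤ ·) A := by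
    intro y hy z hz
    refine ⟨y ⊔ z, ⟨?_, hy.2.1.trans le_sup_left, sup_le hy.2.2 hz.2.2⟩, le_sup_left, le_sup_right⟩
    exact hB.mem_of_le (B.add_mem hy.1 hz.1) (hy.2.1.trans le_sup_left)
      (sup_le (le_add_of_nonneg_right hz.2.1) (le_add_of_nonneg_left hy.2.1))
  have hmem : sSup A ∈ B := hB.sup_mem A _ (fun z hz => hz.1) hne hdir (fun z hz => hz.2.1) hlub
  have h0 : 0 ≤ sSup A := hlub.1 ⟨B.zero_mem, le_rfl, hx⟩
  have hle : sSup A ≤ x := hlub.2 fun z hz => hz.2.2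
  refine ⟨sSup A, x - sSup A, h0, sub_nonneg.2 hle, hmem, ?_, by abel⟩
  intro w hw
  rw [abs_of_nonneg (sub_nonneg.2 hle)]
  set d := (x - sSup A) ⊓ |w| with hd
  have hd0 : 0 ≤ d := le_inf (sub_nonneg.2 hle) (abs_nonneg w)
  have hdB : d ∈ B :=
    hB.solid w hw d (by rw [abs_of_nonneg hd0]; exact inf_le_right)
  have h1 : sSup A + d ∈ A :=
    ⟨B.add_mem hmem hdB, add_nonneg h0 hd0, le_sub_iff_add_le'.1 inf_le_left⟩
  exact le_antisymm ((add_le_iff_nonpos_right _).1 (hlub.1 h1)) hd0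

theorem IsOrderBand.isCompl {B : Submodule ℝ E} (hB : IsOrderBand B) :
    IsCompl B (perp (B : Set E)) := by
  refine ⟨?_, ?_⟩
  · rw [Submodule.disjoint_def]
    exact fun x hx hx' => eq_zero_of_mem_of_mem_perp hx hx'
  · rw [codisjoint_iff, eq_top_iff]
    intro x _
    obtain ⟨a, b, -, -, ha, hb, hab⟩ := hB.exists_decomp (posPart_nonneg x)
    obtain ⟨c, d, -, -, hc, hd, hcd⟩ := hB.exists_decomp (negPart_nonneg x)
    refine Submodule.mem_sup.2 ⟨a - c, B.sub_mem ha hc, b - d, Submodule.sub_mem _ hb hd, ?_⟩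
    rw [← posPart_sub_negPart x, hab, hcd]
    abel

/-- The band projection onto `B`. -/
noncomputable def bandProj {B : Submodule ℝ E} (hB : IsOrderBand B) : E →ₗ[ℝ] E :=
  B.projection (perp (B : Set E)) hB.isCompl

variable {B : Submodule ℝ E} (hB : IsOrderBand B)

theorem bandProj_mem (x : E) : bandProj hB x ∈ B :=
  Submodule.projection_apply_mem _ x

theorem sub_bandProj_mem (x : E) : x - bandProj hB x ∈ perp (B : Set E) :=
  Submodule.sub_projection_mem _ x

theorem bandProj_eq {a x : E} (ha : a ∈ B) (hb : x - a ∈ perp (B : Set E)) : bandProj hB x = a :=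
  (eq_and_eq_of_add_eq_add (bandProj_mem hB x) ha (sub_bandProj_mem hB x) hb (by abel)).1

theorem bandProj_nonneg_le {x : E} (hx : 0 ≤ x) : 0 ≤ bandProj hB x ∧ bandProj hB x ≤ x := by
  obtain ⟨a, b, ha, hb, haB, hbB, rfl⟩ := hB.exists_decomp hx
  rw [bandProj_eq hB haB (by simpa using hbB)]
  exact ⟨ha, le_add_of_nonneg_right hb⟩

end BandProjection

section Operators

variable [Lattice E] [AddCommGroup E] [IsOrderedAddMonoid E] [Module ℝ E]
  [Lattice F] [AddCommGroup F] [IsOrderedAddMonoid F] [Module ℝ F] {S T : E →ₗ[ℝ] F}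

theorem opLE.map_nonneg (hT : opLE 0 T) {x : E} (hx : 0 ≤ x) : 0 ≤ T x := hT x hx

theorem opLE.map_mono (hT : opLE 0 T) {x y : E} (h : x ≤ y) : T x ≤ T y := by
  have := hT.map_nonneg (sub_nonneg.2 h)
  rwa [map_sub, sub_nonneg] at this

theorem orderBounded_of_nonneg (hT : opLE 0 T) : OrderBounded T := fun a b =>
  ⟨T a, T b, fun _ ha hb => ⟨hT.map_mono ha, hT.map_mono hb⟩⟩

theorem isModOp_self_of_nonneg (hT : opLE 0 T) : IsModOp T T := by
  refine ⟨orderBounded_of_nonneg hT, fun x _ => le_rfl, fun x hx => ?_, fun R _ h _ => h⟩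
  exact (neg_nonpos.2 (hT.map_nonneg hx)).trans (hT.map_nonneg hx)

theorem opLE.smul [PosSMulMono ℝ F] (hT : opLE 0 T) {c : ℝ} (hc : 0 ≤ c) : opLE 0 (c • T) :=
  fun _ hx => smul_nonneg hc (hT.map_nonneg hx)

theorem OrderContinuous'.smul [PosSMulMono ℝ F] (hT : OrderContinuous' T) {c : ℝ} (hc : 0 ≤ c) :
    OrderContinuous' (c • T) := by
  intro D hne hdir hD
  have h := hT D hne hdir hD
  rcases hc.eq_or_lt with rfl | hc
  · obtain ⟨d, hd⟩ := hne
    have : ⇑((0 : ℝ) • T) '' D = {0} := by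
      ext y
      simp only [zero_smul, LinearMap.zero_apply, Set.mem_image, Set.mem_singleton_iff]
      exact ⟨fun ⟨_, _, h⟩ => h.symm, fun h => ⟨d, hd, h.symm⟩⟩
    rw [this]
    exact isGLB_singleton
  · refine ⟨?_, ?_⟩
    · rintro _ ⟨d, hd, rfl⟩
      exact smul_nonneg hc.le (h.1 ⟨d, hd, rfl⟩)
    · intro b hb
      have h1 : c⁻¹ • b ≤ 0 := by
        refine h.2 ?_
        rintro _ ⟨d, hd, rfl⟩
        have := smul_le_smul_of_nonneg_left (hb ⟨d, hd, rfl⟩) (inv_nonneg.2 hc.le)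
        rwa [LinearMap.smul_apply, inv_smul_smul₀ hc.ne'] at this
      have := smul_le_smul_of_nonneg_left h1 hc.le
      rwa [smul_inv_smul₀ hc.ne', smul_zero] at this

theorem isGLB_image_sub {A : Set E} {x : E} (hx : IsLUB A x) :
    IsGLB ((fun a => x - a) '' A) 0 := by
  refine ⟨?_, ?_⟩
  · rintro _ ⟨a, ha, rfl⟩
    exact sub_nonneg.2 (hx.1 ha)
  · intro b hb
    have : x ≤ x - b := hx.2 fun a ha => le_sub_comm.1 (hb ⟨a, ha, rfl⟩)
    exact (le_sub_self_iff x).1 this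

theorem OrderContinuous'.isGLB_image_sub (hT : OrderContinuous' T) {A : Set E} {x : E}
    (hne : A.Nonempty) (hdir : DirectedOn (· ≤ ·) A) (hx : IsLUB A x) :
    IsGLB ((fun a => T (x - a)) '' A) 0 := by
  have h := hT _ (hne.image fun a => x - a) ?_ (_root_.isGLB_image_sub hx)
  · rwa [Set.image_image] at h
  · rintro _ ⟨a, ha, rfl⟩ _ ⟨b, hb, rfl⟩
    obtain ⟨c, hc, hac, hbc⟩ := hdir a ha b hb
    exact ⟨x - c, ⟨c, hc, rfl⟩, sub_le_sub_left hac x, sub_le_sub_left hbc x⟩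

theorem OrderContinuous'.isLUB_image (hT : OrderContinuous' T) {A : Set E} {x : E}
    (hne : A.Nonempty) (hdir : DirectedOn (· ≤ ·) A) (hx : IsLUB A x) :
    IsLUB (T '' A) (T x) := by
  have h := hT.isGLB_image_sub hne hdir hx
  refine ⟨?_, ?_⟩
  · rintro _ ⟨a, ha, rfl⟩
    have : 0 ≤ T (x - a) := h.1 ⟨a, ha, rfl⟩
    rwa [map_sub, sub_nonneg] at this
  · intro b hb
    have : T x - b ≤ 0 := by
      refine h.2 ?_
      rintro _ ⟨a, ha, rfl⟩
      have := sub_le_sub_left (hb ⟨a, ha, rfl⟩) (T x)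
      rwa [← map_sub] at this
    exact sub_nonpos.1 this

variable [PosSMulMono ℝ E]

/-- The elements whose moduli are mapped into `W` by a positive operator. -/
def absPreimage (hT : opLE 0 T) {W : Submodule ℝ F} (hW : IsOrderBand W) : Submodule ℝ E :=
  solidSubmodule {x | T |x| ∈ W} (by simp)
    (by
      intro x hx y hy
      refine hW.mem_of_le (W.add_mem hx hy) (hT.map_nonneg (abs_nonneg _)) ?_
      rw [← map_add]
      exact hT.map_mono (abs_add_le x y))
    (by
      intro x hx y hyx
      exact hW.mem_of_le hx (hT.map_nonneg (abs_nonneg _)) (hT.map_mono hyx))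

theorem mem_absPreimage {hT : opLE 0 T} {W : Submodule ℝ F} {hW : IsOrderBand W} {x : E} :
    x ∈ absPreimage hT hW ↔ T |x| ∈ W := Iff.rfl

theorem isOrderBand_absPreimage (hT : opLE 0 T) (hTc : OrderContinuous' T) {W : Submodule ℝ F}
    (hW : IsOrderBand W) : IsOrderBand (absPreimage hT hW) where
  solid := by
    intro x hx y hyx
    exact hW.mem_of_le hx (hT.map_nonneg (abs_nonneg _)) (hT.map_mono hyx)
  sup_mem := by
    intro A x hA hne hdir hpos hx
    have hx0 : 0 ≤ x := by
      obtain ⟨a, ha⟩ := hne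
      exact (hpos a ha).trans (hx.1 ha)
    rw [mem_absPreimage, abs_of_nonneg hx0]
    refine hW.sup_mem (T '' A) (T x) ?_ (hne.image T) ?_ ?_ (hTc.isLUB_image hne hdir hx)
    · rintro _ ⟨a, ha, rfl⟩
      have := hA ha
      rwa [SetLike.mem_coe, mem_absPreimage, abs_of_nonneg (hpos a ha)] at this
    · rintro _ ⟨a, ha, rfl⟩ _ ⟨b, hb, rfl⟩
      obtain ⟨c, hc, hac, hbc⟩ := hdir a ha b hb
      exact ⟨T c, ⟨c, hc, rfl⟩, hT.map_mono hac, hT.map_mono hbc⟩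
    · rintro _ ⟨a, ha, rfl⟩
      exact hT.map_nonneg (hpos a ha)

/-- The elements `x` such that `T ≤ S` on the order ideal generated by `x`. -/
def domBand (S T : E →ₗ[ℝ] F) : Submodule ℝ E :=
  solidSubmodule {x | ∀ y, 0 ≤ y → y ≤ |x| → T y ≤ S y}
    (by
      intro y hy hy'
      rw [abs_zero] at hy'
      simp [le_antisymm hy' hy])
    (by
      intro x hx y hy z hz hzxy
      obtain ⟨a, b, ha, hb, hax, hby, rfl⟩ := nonneg_add_inf_decomp (abs_nonneg x) (abs_nonneg y)
        hz (hzxy.trans (abs_add_le x y))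
      rw [map_add, map_add]
      exact add_le_add (hx a ha hax) (hy b hb hby))
    (fun _ hx _ hyx z hz hzy => hx z hz (hzy.trans hyx))

theorem mem_domBand {x : E} : x ∈ domBand S T ↔ ∀ y, 0 ≤ y → y ≤ |x| → T y ≤ S y := Iff.rfl

theorem le_of_mem_domBand {x : E} (hx : 0 ≤ x) (h : x ∈ domBand S T) : T x ≤ S x :=
  h x hx (le_abs_self x)

theorem isOrderBand_domBand (hS : opLE 0 S) (hT : opLE 0 T) (hTc : OrderContinuous' T) :
    IsOrderBand (domBand S T) where
  solid := fun _ hx _ hyx z hz hzy => hx z hz (hzy.trans hyx)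
  sup_mem := by
    intro A x hA hne hdir hpos hx y hy hyx
    have hx0 : 0 ≤ x := by
      obtain ⟨a, ha⟩ := hne
      exact (hpos a ha).trans (hx.1 ha)
    rw [abs_of_nonneg hx0] at hyx
    refine sub_nonpos.1 ((hTc.isGLB_image_sub hne hdir hx).2 ?_)
    rintro _ ⟨a, ha, rfl⟩
    have h1 : T (y ⊓ a) ≤ S (y ⊓ a) :=
      hA ha _ (le_inf hy (hpos a ha)) (inf_le_right.trans (le_abs_self a))
    have h2 : S (y ⊓ a) ≤ S y := hS.map_mono inf_le_left
    have h3 : T (y - y ⊓ a) ≤ T (x - a) := by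
      refine hT.map_mono ?_
      rw [sub_inf, sub_self]
      exact sup_le (sub_nonneg.2 (hx.1 ha)) (sub_le_sub_right hyx a)
    calc T y - S y ≤ T y - T (y ⊓ a) := sub_le_sub_left (h1.trans h2) _
      _ = T (y - y ⊓ a) := (map_sub T _ _).symm
      _ ≤ T (x - a) := h3

end Operators

section Hahn

variable [ConditionallyCompleteLattice E] [AddCommGroup E] [IsOrderedAddMonoid E]
  [Module ℝ E] [PosSMulMono ℝ E]
  [ConditionallyCompleteLattice F] [AddCommGroup F] [IsOrderedAddMonoid F]
  [Module ℝ F] [PosSMulMono ℝ F] {S T : E →ₗ[ℝ] F}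

theorem map_mem_perp (hloc : ∀ x : E, 0 ≤ x → InBandF (T x) (S x)) {W : Set F} {x : E}
    (hx : 0 ≤ x) (h : T x ∈ perp W) : S x ∈ perp W := by
  intro w hw
  refine hloc x hx w ?_
  rw [inf_comm]
  exact h w hw

/-- If `c • T v ≤ S v` fails, then some nonzero `v' ≤ v` satisfies
`S v' ≤ c • T v'`. -/
theorem exists_le_map_le_smul (hT : opLE 0 T)
    (hM : ∀ x : E, 0 ≤ x → ⇑T '' Set.Icc 0 x = Set.Icc 0 (T x))
    (hloc : ∀ x : E, 0 ≤ x → InBandF (T x) (S x)) (c : ℝ) {v : E} (hv : 0 ≤ v)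
    (h : ¬ c • T v ≤ S v) : ∃ v', 0 ≤ v' ∧ v' ≤ v ∧ v' ≠ 0 ∧ S v' ≤ c • T v' := by
  set d : F := c • T v - S v with hd
  set w : F := d⁺ with hw
  have hB : IsOrderBand (perp (perp {w} : Set F)) := isOrderBand_perp _
  obtain ⟨a, b, ha, hb, haB, hbB, hab⟩ := hB.exists_decomp (hT.map_nonneg hv)
  obtain ⟨v', ⟨hv'0, hv'v⟩, hTv'⟩ : a ∈ ⇑T '' Set.Icc 0 v := by
    rw [hM v hv]
    exact ⟨ha, by rw [hab]; exact le_add_of_nonneg_right hb⟩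
  have hTb : T (v - v') = b := by rw [map_sub, hab, hTv']; abel
  have h1 : S v' ∈ perp (perp {w} : Set F) := map_mem_perp hloc hv'0 (by rwa [hTv'])
  have h2 : S (v - v') ∈ perp (perp (perp {w} : Set F) : Set F) :=
    map_mem_perp hloc (sub_nonneg.2 hv'v) (by rwa [hTb])
  have hneg : -d⁻ ∈ perp (perp (perp {w} : Set F) : Set F) := by
    refine Submodule.neg_mem _ fun z hz => ?_
    rw [inf_comm]
    exact hz _ (negPart_mem_perp_posPart d)
  have hsum : (c • T v' - S v') + (c • T (v - v') - S (v - v')) = w + -d⁻ := by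
    rw [hw, ← sub_eq_add_neg, posPart_sub_negPart, hd, map_sub, map_sub, smul_sub]
    abel
  have hkey := (eq_and_eq_of_add_eq_add
    (Submodule.sub_mem _ (Submodule.smul_mem _ c (by rwa [hTv'])) h1) (mem_perp_perp_self w)
    (Submodule.sub_mem _ (Submodule.smul_mem _ c (by rwa [hTb])) h2) hneg hsum).1
  refine ⟨v', hv'0, hv'v, ?_, ?_⟩
  · rintro rfl
    rw [map_zero, map_zero, smul_zero, sub_zero] at hkey
    exact h (sub_nonpos.1 (posPart_eq_zero.1 hkey.symm))
  · rw [← sub_nonneg, hkey]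
    exact posPart_nonneg d

theorem map_le_smul_of_mem_perp (hT : opLE 0 T) (hSc : OrderContinuous' S)
    (hM : ∀ x : E, 0 ≤ x → ⇑T '' Set.Icc 0 x = Set.Icc 0 (T x))
    (hloc : ∀ x : E, 0 ≤ x → InBandF (T x) (S x)) {c : ℝ} (hc : 0 ≤ c) {x : E} (hx : 0 ≤ x)
    (h : x ∈ perp (domBand S (c • T) : Set E)) : S x ≤ c • T x := by
  set Z : Set E := {u | 0 ≤ u ∧ u ≤ x ∧ S u ≤ c • T u} with hZ
  obtain ⟨u, hu⟩ : ∃ u, Maximal (· ∈ Z) u := by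
    refine zorn_le₀ Z fun C hCZ hC => ?_
    rcases C.eq_empty_or_nonempty with rfl | hne
    · exact ⟨0, ⟨le_rfl, hx, by simp⟩, by simp⟩
    have hlub : IsLUB C (sSup C) := isLUB_csSup hne ⟨x, fun z hz => (hCZ hz).2.1⟩
    refine ⟨sSup C, ⟨?_, hlub.2 fun z hz => (hCZ hz).2.1, ?_⟩, hlub.1⟩
    · obtain ⟨z, hz⟩ := hne
      exact (hCZ hz).1.trans (hlub.1 hz)
    · refine (hSc.isLUB_image hne hC.directedOn hlub).2 ?_
      rintro _ ⟨z, hz, rfl⟩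
      exact (hCZ hz).2.2.trans ((hT.smul hc).map_mono (hlub.1 hz))
  obtain ⟨⟨hu0, hux, hSu⟩, hmax⟩ := hu
  have hsub : 0 ≤ x - u := sub_nonneg.2 hux
  have hmem : x - u ∈ domBand S (c • T) := by
    intro v hv hvx
    by_contra hcon
    obtain ⟨v', hv'0, hv'v, hne, hle⟩ := exists_le_map_le_smul hT hM hloc c hv hcon
    rw [abs_of_nonneg hsub] at hvx
    have hmem' : u + v' ∈ Z := by
      refine ⟨add_nonneg hu0 hv'0, le_sub_iff_add_le'.1 (hv'v.trans hvx), ?_⟩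
      rw [map_add, map_add, smul_add]
      exact add_le_add hSu hle
    have := hmax hmem' (le_add_of_nonneg_right hv'0)
    exact hne (le_antisymm ((add_le_iff_nonpos_right u).1 this) hv'0)
  have hzero : x - u = 0 := by
    refine eq_zero_of_mem_of_mem_perp (W := (domBand S (c • T) : Set E)) hmem ?_
    exact (isOrderBand_perp _).mem_of_le h hsub (sub_le_self x hu0)
  rwa [sub_eq_zero.1 hzero]

end Hahn

section Approximation

open scoped NNReal

variable [ConditionallyCompleteLattice E] [AddCommGroup E] [IsOrderedAddMonoid E]
  [Module ℝ E] [PosSMulMono ℝ E]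
  [ConditionallyCompleteLattice F] [AddCommGroup F] [IsOrderedAddMonoid F]
  [Module ℝ F] [PosSMulMono ℝ F] {S T : E →ₗ[ℝ] F}

theorem bandProj_mono {B : Submodule ℝ E} (hB : IsOrderBand B) {x y : E} (h : x ≤ y) :
    bandProj hB x ≤ bandProj hB y := by
  have := (bandProj_nonneg_le hB (sub_nonneg.2 h)).1
  rwa [map_sub, sub_nonneg] at this

theorem abs_bandProj_le {B : Submodule ℝ E} (hB : IsOrderBand B) (x : E) :
    |bandProj hB x| ≤ |x| := by
  refine le_trans ?_ (bandProj_nonneg_le hB (abs_nonneg x)).2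
  rw [abs_le', ← map_neg]
  exact ⟨bandProj_mono hB (le_abs_self x), bandProj_mono hB (neg_le_abs x)⟩

theorem bandProj_mem_of_mem {B C : Submodule ℝ E} (hB : IsOrderBand B) (hC : IsOrderBand C)
    {x : E} (hx : x ∈ C) : bandProj hB x ∈ C :=
  hC.solid x hx _ (abs_bandProj_le hB x)

theorem domBand_smul_anti (hT : opLE 0 T) {c d : ℝ≥0} (hcd : c ≤ d) :
    domBand S ((d : ℝ) • T) ≤ domBand S ((c : ℝ) • T) := by
  intro x hx y hy hyx
  refine le_trans ?_ (hx y hy hyx)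
  have := smul_nonneg (sub_nonneg.2 (NNReal.coe_le_coe.2 hcd)) (hT.map_nonneg hy)
  rwa [sub_smul, sub_nonneg] at this

theorem perp_anti {V W : Set E} (h : V ⊆ W) : perp W ≤ perp V :=
  fun _ hx w hw => hx w (h hw)

variable (hB : ∀ c : ℝ≥0, IsOrderBand (domBand S ((c : ℝ) • T)))

theorem bandProj_domBand_zero (hS : opLE 0 S) (x : E) : bandProj (hB 0) x = x := by
  refine bandProj_eq (hB 0) ?_ (by rw [sub_self]; exact Submodule.zero_mem _)
  intro y hy _
  simpa using hS.map_nonneg hy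

theorem sub_bandProj_mem_perp (hT : opLE 0 T) {c d : ℝ≥0} (hcd : c ≤ d) (x : E) :
    bandProj (hB c) x - bandProj (hB d) x ∈ perp (domBand S ((d : ℝ) • T) : Set E) := by
  have h1 := sub_bandProj_mem (hB d) x
  have h2 := perp_anti (domBand_smul_anti (S := S) hT hcd) (sub_bandProj_mem (hB c) x)
  have := Submodule.sub_mem _ h1 h2
  rwa [sub_sub_sub_cancel_left] at this

theorem bandProj_domBand_anti (hT : opLE 0 T) {c d : ℝ≥0} (hcd : c ≤ d) {x : E} (hx : 0 ≤ x) :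
    bandProj (hB d) x ≤ bandProj (hB c) x := by
  have h := bandProj_eq (hB d) (bandProj_mem (hB d) x) (sub_bandProj_mem_perp hB hT hcd x)
  rw [← h]
  exact (bandProj_nonneg_le (hB d) (bandProj_nonneg_le (hB c) hx).1).2

theorem map_bandProj_sub_bounds (hT : opLE 0 T)
    (hH : ∀ (c : ℝ≥0) (x : E), 0 ≤ x → x ∈ perp (domBand S ((c : ℝ) • T) : Set E) →
      S x ≤ (c : ℝ) • T x) {c d : ℝ≥0} (hcd : c ≤ d) {x : E} (hx : 0 ≤ x) :
    (c : ℝ) • (T (bandProj (hB c) x) - T (bandProj (hB d) x)) ≤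
        S (bandProj (hB c) x) - S (bandProj (hB d) x) ∧
      S (bandProj (hB c) x) - S (bandProj (hB d) x) ≤
        (d : ℝ) • (T (bandProj (hB c) x) - T (bandProj (hB d) x)) := by
  have h0 := sub_nonneg.2 (bandProj_domBand_anti hB hT hcd hx)
  rw [← map_sub, ← map_sub]
  refine ⟨?_, hH d _ h0 (sub_bandProj_mem_perp hB hT hcd x)⟩
  exact le_of_mem_domBand h0 (Submodule.sub_mem _ (bandProj_mem (hB c) x)
    (domBand_smul_anti hT hcd (bandProj_mem (hB d) x)))

/-- Lower Lebesgue sum with mesh `δ` and `N` levels of the density of `S` with respect to `T`. -/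
noncomputable def lebesgueSum (δ : ℝ≥0) (N : ℕ) : E →ₗ[ℝ] E :=
  ∑ k ∈ Finset.range N, (δ : ℝ) • bandProj (hB ((k + 1 : ℕ) * δ))

theorem lebesgueSum_succ (δ : ℝ≥0) (N : ℕ) (x : E) :
    lebesgueSum hB δ (N + 1) x =
      lebesgueSum hB δ N x + (δ : ℝ) • bandProj (hB ((N + 1 : ℕ) * δ)) x := by
  simp [lebesgueSum, Finset.sum_range_succ]

theorem lebesgueSum_bounds (δ : ℝ≥0) (N : ℕ) {x : E} (hx : 0 ≤ x) :
    0 ≤ lebesgueSum hB δ N x ∧ lebesgueSum hB δ N x ≤ ((N : ℝ) * δ) • x := by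
  induction N with
  | zero => simp [lebesgueSum]
  | succ k ih =>
    have h := bandProj_nonneg_le (hB ((k + 1 : ℕ) * δ)) hx
    rw [lebesgueSum_succ]
    refine ⟨add_nonneg ih.1 (smul_nonneg δ.2 h.1), ?_⟩
    have : (((k + 1 : ℕ) : ℝ) * δ) • x = ((k : ℝ) * δ) • x + (δ : ℝ) • x := by
      push_cast
      module
    rw [this]
    exact add_le_add ih.2 (smul_le_smul_of_nonneg_left h.2 δ.2)

theorem lebesgueSum_mem (δ : ℝ≥0) (N : ℕ) {C : Submodule ℝ E} (hC : IsOrderBand C) {x : E}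
    (hx : x ∈ C) : lebesgueSum hB δ N x ∈ C := by
  rw [lebesgueSum, LinearMap.sum_apply]
  exact Submodule.sum_mem _ fun k _ => Submodule.smul_mem _ _ (bandProj_mem_of_mem _ hC hx)

theorem map_lebesgueSum_bounds (hS : opLE 0 S) (hT : opLE 0 T)
    (hH : ∀ (c : ℝ≥0) (x : E), 0 ≤ x → x ∈ perp (domBand S ((c : ℝ) • T) : Set E) →
      S x ≤ (c : ℝ) • T x) (δ : ℝ≥0) (N : ℕ) {x : E} (hx : 0 ≤ x) :
    T (lebesgueSum hB δ N x) + (S (bandProj (hB (N * δ)) x) -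
        ((N * δ : ℝ≥0) : ℝ) • T (bandProj (hB (N * δ)) x)) ≤ S x ∧
      S x ≤ T (lebesgueSum hB δ N x) + (S (bandProj (hB (N * δ)) x) -
        ((N * δ : ℝ≥0) : ℝ) • T (bandProj (hB (N * δ)) x)) +
        (δ : ℝ) • (T x - T (bandProj (hB (N * δ)) x)) := by
  induction N with
  | zero =>
    have : ((0 : ℕ) : ℝ≥0) * δ = 0 := by simp
    rw [this, bandProj_domBand_zero hB hS]
    simp [lebesgueSum]
  | succ N ih =>
    have hle : (N : ℝ≥0) * δ ≤ ((N + 1 : ℕ) : ℝ≥0) * δ := by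
      gcongr
      simp
    obtain ⟨h1, h2⟩ := map_bandProj_sub_bounds hB hT hH hle hx
    rw [lebesgueSum_succ, map_add, map_smul]
    have hcast : ((((N + 1 : ℕ) : ℝ≥0) * δ : ℝ≥0) : ℝ) = ((N * δ : ℝ≥0) : ℝ) + δ := by
      push_cast
      ring
    generalize T (bandProj (hB (N * δ)) x) = a at *
    generalize S (bandProj (hB (N * δ)) x) = s at *
    generalize T (bandProj (hB ((N + 1 : ℕ) * δ)) x) = a' at *
    generalize S (bandProj (hB ((N + 1 : ℕ) * δ)) x) = s' at *
    generalize T (lebesgueSum hB δ N x) = t at *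
    rw [hcast] at h2 ⊢
    generalize (((N : ℝ≥0) * δ : ℝ≥0) : ℝ) = c at *
    constructor
    · calc t + (δ : ℝ) • a' + (s' - (c + δ) • a') = t + (s - c • a) + (c • (a - a') - (s - s')) := by
            module
        _ ≤ t + (s - c • a) + 0 := by gcongr; exact sub_nonpos.2 h1
        _ ≤ S x := by rw [add_zero]; exact ih.1
    · calc S x ≤ t + (s - c • a) + (δ : ℝ) • (T x - a) := ih.2
        _ = t + (δ : ℝ) • a' + (s' - (c + δ) • a') + (δ : ℝ) • (T x - a') +
            ((s - s') - (c + δ) • (a - a')) := by module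
        _ ≤ t + (δ : ℝ) • a' + (s' - (c + δ) • a') + (δ : ℝ) • (T x - a') + 0 := by
            gcongr
            exact sub_nonpos.2 h2
        _ = _ := add_zero _

theorem nonpos_of_forall_le_map_bandProj (hArchF : ∀ x y : F, (∀ n : ℕ, n • x ≤ y) → x ≤ 0)
    (hT : opLE 0 T) (hSc : OrderContinuous' S)
    (hloc : ∀ x : E, 0 ≤ x → InBandF (T x) (S x)) {x : E} (hx : 0 ≤ x) {b : F}
    (hb : ∀ m : ℕ, b ≤ S (bandProj (hB (m + 1 : ℕ)) x)) : b ≤ 0 := by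
  set A : Set E := Set.range fun m : ℕ => bandProj (hB (m + 1 : ℕ)) x with hA
  have hbdd : BddBelow A := by
    refine ⟨0, ?_⟩
    rintro _ ⟨m, rfl⟩
    exact (bandProj_nonneg_le _ hx).1
  have hglb : IsGLB A (sInf A) := isGLB_csInf (Set.range_nonempty _) hbdd
  set y := sInf A with hy
  have hy0 : 0 ≤ y := by
    refine hglb.2 ?_
    rintro _ ⟨m, rfl⟩
    exact (bandProj_nonneg_le _ hx).1
  have hyB : ∀ m : ℕ, ((m + 1 : ℕ) : ℝ) • T y ≤ S y := by
    intro m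
    have hm : y ∈ domBand S ((((m + 1 : ℕ) : ℝ≥0) : ℝ) • T) :=
      (hB _).mem_of_le (bandProj_mem _ x) hy0 (hglb.1 ⟨m, rfl⟩)
    have := le_of_mem_domBand hy0 hm
    rwa [NNReal.coe_natCast] at this
  have hTy : T y = 0 := by
    refine le_antisymm (hArchF _ (S y) fun n => ?_) (hT.map_nonneg hy0)
    have := hyB n
    rw [Nat.cast_smul_eq_nsmul, succ_nsmul] at this
    exact (le_add_of_nonneg_right (hT.map_nonneg hy0)).trans this
  have hSy : S y = 0 := by
    refine eq_zero_of_mem_of_mem_perp (W := {S y}) rfl ?_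
    rw [mem_perp_singleton]
    refine hloc y hy0 (S y) ?_
    rw [hTy, abs_zero]
    exact inf_eq_right.2 (abs_nonneg _)
  have hD : IsGLB ((fun a => a - y) '' A) 0 := by
    refine ⟨?_, ?_⟩
    · rintro _ ⟨a, ha, rfl⟩
      exact sub_nonneg.2 (hglb.1 ha)
    · intro z hz
      have : z + y ≤ y := hglb.2 fun a ha => le_sub_iff_add_le.1 (hz ⟨a, ha, rfl⟩)
      exact (add_le_iff_nonpos_left).1 this
  refine (hSc _ ((Set.range_nonempty _).image _) ?_ hD).2 ?_
  · rintro _ ⟨_, ⟨m, rfl⟩, rfl⟩ _ ⟨_, ⟨n, rfl⟩, rfl⟩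
    refine ⟨_, ⟨_, ⟨max m n, rfl⟩, rfl⟩, sub_le_sub_right ?_ y, sub_le_sub_right ?_ y⟩ <;>
      refine bandProj_domBand_anti hB hT ?_ hx <;> gcongr <;> simp
  · rintro _ ⟨_, ⟨_, ⟨m, rfl⟩, rfl⟩, rfl⟩
    rw [map_sub, hSy, sub_zero]
    exact hb m

/-- A local Radon–Nikodým theorem: densities of `S` with respect to a Maharam operator `T`. -/
theorem exists_density_seq (hArchF : ∀ x y : F, (∀ n : ℕ, n • x ≤ y) → x ≤ 0)
    (hS : opLE 0 S) (hT : opLE 0 T) (hSc : OrderContinuous' S) (hTc : OrderContinuous' T)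
    (hM : ∀ x : E, 0 ≤ x → ⇑T '' Set.Icc 0 x = Set.Icc 0 (T x))
    (hloc : ∀ x : E, 0 ≤ x → InBandF (T x) (S x)) :
    ∃ ρ : ℕ → (E →ₗ[ℝ] E),
      (∀ n : ℕ, (∀ x : E, 0 ≤ x → 0 ≤ ρ n x ∧ ρ n x ≤ ((n : ℝ) + 1) • x) ∧
        (∀ x y : E, |x| ⊓ |y| = 0 → |ρ n x| ⊓ |y| = 0)) ∧
      ∀ x : E, 0 ≤ x → IsLUB (Set.range fun n => T (ρ n x)) (S x) := by
  have hB : ∀ c : ℝ≥0, IsOrderBand (domBand S ((c : ℝ) • T)) := fun c =>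
    isOrderBand_domBand hS (hT.smul c.2) (hTc.smul c.2)
  have hH : ∀ (c : ℝ≥0) (x : E), 0 ≤ x → x ∈ perp (domBand S ((c : ℝ) • T) : Set E) →
      S x ≤ (c : ℝ) • T x := fun c x hx h => map_le_smul_of_mem_perp hT hSc hM hloc c.2 hx h
  set δ : ℕ → ℝ≥0 := fun n => ((n + 1 : ℕ) : ℝ≥0)⁻¹ with hδ
  have hlevel : ∀ n : ℕ, (((n + 1) ^ 2 : ℕ) : ℝ≥0) * δ n = ((n + 1 : ℕ) : ℝ≥0) := by
    intro n
    have : ((n : ℝ≥0) + 1) ≠ 0 := by positivity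
    simp only [hδ]
    push_cast
    field_simp
  refine ⟨fun n => lebesgueSum hB (δ n) ((n + 1) ^ 2), fun n => ⟨fun x hx => ?_, ?_⟩, ?_⟩
  · have h := lebesgueSum_bounds hB (δ n) ((n + 1) ^ 2) hx
    have hc : (((n + 1) ^ 2 : ℕ) : ℝ) * (δ n : ℝ) = (n : ℝ) + 1 := by
      have := congrArg NNReal.toReal (hlevel n)
      push_cast at this ⊢
      exact this
    rwa [hc] at h
  · intro x y hxy
    exact mem_perp_singleton.1
      (lebesgueSum_mem hB _ _ (isOrderBand_perp {y}) (mem_perp_singleton.2 hxy))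
  · intro x hx
    have hbd := fun n : ℕ => map_lebesgueSum_bounds hB hS hT hH (δ n) ((n + 1) ^ 2) hx
    simp only [hlevel] at hbd
    refine ⟨?_, fun u hu => ?_⟩
    · rintro _ ⟨n, rfl⟩
      refine le_trans (le_add_of_nonneg_right (sub_nonneg.2 ?_)) (hbd n).1
      exact le_of_mem_domBand (bandProj_nonneg_le _ hx).1 (bandProj_mem (hB _) x)
    · have hTx := hT.map_nonneg hx
      have hstep : ∀ n : ℕ, S x - u ≤ S (bandProj (hB (n + 1 : ℕ)) x) + (δ n : ℝ) • T x := by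
        intro n
        have hq := hT.map_nonneg (bandProj_nonneg_le (hB (n + 1 : ℕ)) hx).1
        rw [sub_le_iff_le_add']
        refine (hbd n).2.trans ?_
        rw [← add_assoc]
        refine add_le_add (add_le_add (hu ⟨n, rfl⟩) ?_) ?_
        · exact sub_le_self _ (smul_nonneg (NNReal.coe_nonneg _) hq)
        · exact smul_le_smul_of_nonneg_left (sub_le_self _ hq) (δ n).2
      refine sub_nonpos.1 (nonpos_of_forall_le_map_bandProj hB hArchF hT hSc hloc hx fun m => ?_)
      refine sub_nonpos.1 (hArchF _ (T x) fun n => ?_)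
      have h1 : S x - u - S (bandProj (hB (m + 1 : ℕ)) x) ≤ (δ (n + m) : ℝ) • T x := by
        rw [sub_le_iff_le_add']
        refine (hstep (n + m)).trans (add_le_add_left (hS.map_mono ?_) _)
        refine bandProj_domBand_anti hB hT ?_ hx
        gcongr
        simp
      rw [← Nat.cast_smul_eq_nsmul ℝ]
      refine (smul_le_smul_of_nonneg_left h1 (Nat.cast_nonneg n)).trans ?_
      rw [smul_smul]
      have h2 : (n : ℝ) * (δ (n + m) : ℝ) ≤ 1 := by
        simp only [hδ]
        push_cast
        rw [← div_eq_mul_inv, div_le_one (by positivity)]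
        have : (0 : ℝ) ≤ m := Nat.cast_nonneg m
        linarith
      have h3 := smul_nonneg (sub_nonneg.2 h2) hTx
      rwa [sub_smul, one_smul, sub_nonneg] at h3

end Approximation

section RadonNikodym

variable [ConditionallyCompleteLattice E] [AddCommGroup E] [IsOrderedAddMonoid E]
  [Module ℝ E] [PosSMulMono ℝ E]
  [ConditionallyCompleteLattice F] [AddCommGroup F] [IsOrderedAddMonoid F]
  [Module ℝ F] [PosSMulMono ℝ F] {S T : E →ₗ[ℝ] F}

theorem inBandF_of_inBandOp (hS : opLE 0 S) (hT : opLE 0 T) (hTc : OrderContinuous' T)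
    (h : InBandOp T S) {x : E} (hx : 0 ≤ x) : InBandF (T x) (S x) := by
  have hW : IsOrderBand (perp (perp {T x} : Set F)) := isOrderBand_perp _
  have hW' : IsOrderBand (perp {T x}) := isOrderBand_perp _
  have hG := isOrderBand_absPreimage hT hTc hW
  have hxG : x ∈ absPreimage hT hW := by
    rw [mem_absPreimage, abs_of_nonneg hx]
    exact mem_perp_perp_self _
  set P := bandProj hG
  set R : E →ₗ[ℝ] F := bandProj hW' ∘ₗ S ∘ₗ P with hR
  have hRS : ∀ z : E, 0 ≤ z → 0 ≤ R z ∧ R z ≤ S z := by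
    intro z hz
    have h1 := bandProj_nonneg_le hG hz
    have h2 := bandProj_nonneg_le hW' (hS.map_nonneg h1.1)
    exact ⟨h2.1, h2.2.trans (hS.map_mono h1.2)⟩
  have hRpos : opLE 0 R := fun z hz => (hRS z hz).1
  have hPP : ∀ z : E, P (P z) = P z := fun z =>
    bandProj_eq hG (bandProj_mem hG z) (by rw [sub_self]; exact Submodule.zero_mem _)
  have hdisj : DisjOp R T := by
    refine ⟨R, T, isModOp_self_of_nonneg hRpos, isModOp_self_of_nonneg hT, hRpos, hT, ?_⟩
    intro V _ hVR hVT z hz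
    have h1 := bandProj_nonneg_le hG hz
    have h2 : V (P z) ≤ 0 := by
      have hR' : R (P z) ∈ perp {T x} := bandProj_mem hW' _
      have hT' : T (P z) ∈ perp (perp {T x} : Set F) := by
        have : P z ∈ absPreimage hT hW := bandProj_mem hG z
        rwa [mem_absPreimage, abs_of_nonneg h1.1] at this
      have h3 := hT' _ hR'
      rw [abs_of_nonneg (hT.map_nonneg h1.1), abs_of_nonneg (hRpos.map_nonneg h1.1)] at h3
      rw [← h3]
      exact le_inf (hVT _ h1.1) (hVR _ h1.1)
    have h4 : V (z - P z) ≤ 0 := by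
      refine (hVR _ (sub_nonneg.2 h1.2)).trans ?_
      rw [hR, LinearMap.comp_apply, LinearMap.comp_apply, map_sub P, hPP, sub_self, map_zero,
        map_zero]
    have h5 := add_le_add h2 h4
    rwa [← map_add, add_sub_cancel, add_zero] at h5
  obtain ⟨mS, mR, hmS, hmR, -, -, hinf⟩ := h R (orderBounded_of_nonneg hRpos) hdisj
  have hRx : R x ≤ 0 := hinf R (orderBounded_of_nonneg hRpos)
    (fun z hz => (hRS z hz).2.trans (hmS.2.1 z hz)) hmR.2.1 x hx
  have hRx0 : bandProj hW' (S x) = 0 := by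
    have hPx : P x = x := bandProj_eq hG hxG (by rw [sub_self]; exact Submodule.zero_mem _)
    have := le_antisymm hRx (hRpos.map_nonneg hx)
    rwa [hR, LinearMap.comp_apply, LinearMap.comp_apply, hPx] at this
  have hmem := sub_bandProj_mem hW' (S x)
  rw [hRx0, sub_zero] at hmem
  exact fun w hw => hmem w (mem_perp_singleton.2 hw)

theorem inBandF_of_isLUB (hT : opLE 0 T) (hTc : OrderContinuous' T) {ρ : ℕ → (E →ₗ[ℝ] E)}
    (hρ : ∀ n : ℕ, (∀ x : E, 0 ≤ x → 0 ≤ ρ n x) ∧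
      (∀ x y : E, |x| ⊓ |y| = 0 → |ρ n x| ⊓ |y| = 0))
    {x : E} (hx : 0 ≤ x) (hlub : IsLUB (Set.range fun n => T (ρ n x)) (S x)) :
    InBandF (T x) (S x) := by
  intro w hw
  have hW : IsOrderBand (perp {w}) := isOrderBand_perp _
  have hG := isOrderBand_absPreimage hT hTc hW
  have hxG : x ∈ absPreimage hT hW := by
    rw [mem_absPreimage, abs_of_nonneg hx, mem_perp_singleton, inf_comm]
    exact hw
  have hmem : ∀ n, T (ρ n x) ∈ perp {w} := by
    intro n
    have h0 := (hρ n).1 x hx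
    obtain ⟨a, b, ha, hb, haG, hbG, hab⟩ := hG.exists_decomp h0
    have hxb : |x| ⊓ |b| = 0 := by
      rw [inf_comm]
      exact hbG x hxG
    have hb0 : b = 0 := by
      have h1 := (hρ n).2 x b hxb
      rw [abs_of_nonneg h0, abs_of_nonneg hb] at h1
      rw [← h1]
      exact (inf_eq_right.2 (by rw [hab]; exact le_add_of_nonneg_left ha)).symm
    rw [hab, hb0, add_zero]
    rwa [mem_absPreimage, abs_of_nonneg ha] at haG
  refine mem_perp_singleton.1 (mem_perp_of_isLUB ?_ (Set.range_nonempty _) ?_ hlub)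
  · rintro _ ⟨n, rfl⟩
    exact hmem n
  · rintro _ ⟨n, rfl⟩
    exact hT.map_nonneg ((hρ n).1 x hx)

theorem inBandOp_of_isLUB (hS : opLE 0 S) {ρ : ℕ → (E →ₗ[ℝ] E)}
    (hρ : ∀ (n : ℕ) (x : E), 0 ≤ x → 0 ≤ ρ n x ∧ ρ n x ≤ ((n : ℝ) + 1) • x)
    (hT : opLE 0 T) (hlub : ∀ x : E, 0 ≤ x → IsLUB (Set.range fun n => T (ρ n x)) (S x)) :
    InBandOp T S := by
  intro R hRb ⟨mR, mT, hmR, hmT, hmR0, hmT0, hinf⟩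
  refine ⟨S, mR, isModOp_self_of_nonneg hS, hmR, hS, hmR0, fun w hwb hwS hwR x hx => ?_⟩
  suffices S x ≤ S x - w x from (le_sub_self_iff _).1 this
  refine (hlub x hx).2 ?_
  rintro _ ⟨n, rfl⟩
  set k : ℝ := ((n : ℝ) + 1)⁻¹ with hk
  have hn : (0 : ℝ) < (n : ℝ) + 1 := by positivity
  have hk0 : 0 ≤ k := inv_nonneg.2 hn.le
  have hk1 : 0 ≤ 1 - k := sub_nonneg.2 (inv_le_one_of_one_le₀ (by simp))
  have hTρ : opLE 0 (T ∘ₗ ρ n) := fun z hz => hT.map_nonneg (hρ n z hz).1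
  set V : E →ₗ[ℝ] F := k • (w - S + T ∘ₗ ρ n) with hV
  have hVb : OrderBounded V := by
    intro a b
    obtain ⟨c, d, hcd⟩ := hwb a b
    refine ⟨k • (c - S b + (T ∘ₗ ρ n) a), k • (d - S a + (T ∘ₗ ρ n) b), fun z haz hzb => ?_⟩
    obtain ⟨h1, h2⟩ := hcd z haz hzb
    exact ⟨smul_le_smul_of_nonneg_left
        (add_le_add (sub_le_sub h1 (hS.map_mono hzb)) (hTρ.map_mono haz)) hk0,
      smul_le_smul_of_nonneg_left
        (add_le_add (sub_le_sub h2 (hS.map_mono haz)) (hTρ.map_mono hzb)) hk0⟩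
  have hVR : opLE V mR := by
    intro z hz
    have h1 : w z - S z + T (ρ n z) ≤ mR z := by
      refine le_trans ?_ (hwR z hz)
      rw [sub_add]
      exact sub_le_self _ (sub_nonneg.2 ((hlub z hz).1 ⟨n, rfl⟩))
    have h2 := smul_nonneg hk1 (hmR0.map_nonneg hz)
    rw [sub_smul, one_smul, sub_nonneg] at h2
    exact (smul_le_smul_of_nonneg_left h1 hk0).trans h2
  have hVT : opLE V mT := by
    intro z hz
    refine le_trans ?_ (hmT.2.1 z hz)
    have h1 : w z - S z + T (ρ n z) ≤ ((n : ℝ) + 1) • T z := by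
      rw [← map_smul]
      refine le_trans ?_ (hT.map_mono (hρ n z hz).2)
      exact (add_le_iff_nonpos_left).2 (sub_nonpos.2 (hwS z hz))
    have h2 := smul_le_smul_of_nonneg_left h1 hk0
    rwa [hk, inv_smul_smul₀ hn.ne'] at h2
  have h3 : V x ≤ 0 := hinf V hVb hVR hVT x hx
  have h4 := smul_le_smul_of_nonneg_left h3 hn.le
  rw [hV, LinearMap.smul_apply, hk, smul_inv_smul₀ hn.ne', smul_zero] at h4
  have h5 : w x - S x + T (ρ n x) ≤ 0 := h4
  rwa [← le_neg_iff_add_nonpos_left, neg_sub] at h5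

end RadonNikodym

theorem radon_nikodym_maharam
    [ConditionallyCompleteLattice E] [AddCommGroup E] [Module ℝ E]
    [CovariantClass E E (· + ·) (· ≤ ·)] [PosSMulMono ℝ E]
    [ConditionallyCompleteLattice F] [AddCommGroup F] [Module ℝ F]
    [CovariantClass F F (· + ·) (· ≤ ·)] [PosSMulMono ℝ F]
    (hArchE : ∀ x y : E, (∀ n : ℕ, n • x ≤ y) → x ≤ 0)
    (hArchF : ∀ x y : F, (∀ n : ℕ, n • x ≤ y) → x ≤ 0)
    (S T : E →ₗ[ℝ] F)
    (hSpos : opLE 0 S) (hTpos : opLE 0 T)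
    (hScont : OrderContinuous' S) (hTcont : OrderContinuous' T)
    -- `T` has the Maharam property: `T([0,x]) = [0,Tx]` for `x ∈ E₊`
    (hMaharam : ∀ x : E, 0 ≤ x → ⇑T '' Set.Icc 0 x = Set.Icc 0 (T x)) :
    (InBandOp T S ↔ ∀ x : E, 0 ≤ x → InBandF (T x) (S x)) ∧
    (InBandOp T S ↔
      ∃ ρ : ℕ → (E →ₗ[ℝ] E),
        (∀ n : ℕ, (∀ x : E, 0 ≤ x → 0 ≤ ρ n x) ∧
          OrderBounded (ρ n) ∧
          (∀ x y : E, |x| ⊓ |y| = 0 → |ρ n x| ⊓ |y| = 0)) ∧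
        ∀ x : E, 0 ≤ x → IsLUB (Set.range fun n => T (ρ n x)) (S x)) := by
  have : IsOrderedAddMonoid E := { add_le_add_left := fun a b h c => add_le_add_left h c }
  have : IsOrderedAddMonoid F := { add_le_add_left := fun a b h c => add_le_add_left h c }
  have h12 : InBandOp T S → ∀ x : E, 0 ≤ x → InBandF (T x) (S x) := fun h _ hx =>
    inBandF_of_inBandOp hSpos hTpos hTcont h hx
  have h23 := exists_density_seq hArchF hSpos hTpos hScont hTcont hMaharam
  have h21 : (∀ x : E, 0 ≤ x → InBandF (T x) (S x)) → InBandOp T S := by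
    intro h
    obtain ⟨ρ, hρ, hlub⟩ := h23 h
    exact inBandOp_of_isLUB hSpos (fun n => (hρ n).1) hTpos hlub
  refine ⟨⟨h12, h21⟩, fun h => ?_, ?_⟩
  · obtain ⟨ρ, hρ, hlub⟩ := h23 (h12 h)
    exact ⟨ρ, fun n => ⟨fun x hx => ((hρ n).1 x hx).1,
      orderBounded_of_nonneg fun x hx => ((hρ n).1 x hx).1, (hρ n).2⟩, hlub⟩
  · rintro ⟨ρ, hρ, hlub⟩
    exact h21 fun x hx =>
      inBandF_of_isLUB hTpos hTcont (fun n => ⟨(hρ n).1, (hρ n).2.2⟩) hx (hlub x hx)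
end
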